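/- (Proposition 1, coordinate form.) Let x : ℝ → ℝ³ be twice differentiable with ‖ẍ(t)‖ ≤ A and ‖ẋ(t)‖ ≤ k for all t ∈ ℝ, where A > 0 and 0 ≤ k < 1 (bounded acceleration and timelike worldline). Let a ∈ ℝ³ with ‖a‖ ≤ 1 and b ∈ ℝ, and let t̃ ∈ ℝ satisfy t̃ + a·x(t̃) = b. Set C := A/(2(1 − k)). Then for every t₀ with C·|t₀ − t̃| < 1, the sequence defined by t_{n+1} = N(t_n) is well defined (indeed 1 + a·ẋ(t_n) ≥ 1 − k > 0 for all n), satisfies |t_{n+1} − t̃| ≤ C·|t_n − t̃|² for all n, hence |t_n − t̃| ≤ C⁻¹·(C·|t₀ − t̃|)^(2^n) for all n, and t_n converges to t̃. -/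

import Mathlib

open scoped RealInnerProductSpace

/-- ℝ³ with its Euclidean inner product. -/
abbrev E3 := EuclideanSpace ℝ (Fin 3)

/-- The Newton–Raphson iteration map `N(t) = (a·(t ẋ(t) − x(t)) + b)/(1 + a·ẋ(t))`. -/
noncomputable def NR (x : ℝ → E3) (a : E3) (b t : ℝ) : ℝ :=
  (⟪a, t • deriv x t - x t⟫ + b) / (1 + ⟪a, deriv x t⟫)

/-- Second-order Taylor estimate for a twice differentiable curve whose second derivative is
bounded, but not assumed continuous. -/
theorem norm_sub_sub_smul_deriv_le {E : Type*} [NormedAddCommGroup E] [NormedSpace ℝ E]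
    {f : ℝ → E} (hf : ∀ s, DifferentiableAt ℝ f s)
    (hf' : ∀ s, DifferentiableAt ℝ (deriv f) s) {M : ℝ}
    (hM : ∀ s, ‖deriv (deriv f) s‖ ≤ M) (t u : ℝ) :
    ‖f u - f t - (u - t) • deriv f t‖ ≤ M / 2 * |u - t| ^ 2 := by
  set d := u - t with hd
  have hline (s : ℝ) : HasDerivAt (fun s : ℝ => t + s * d) d s := by
    simpa using ((hasDerivAt_id s).mul_const d).const_add t
  have hg (s : ℝ) : HasDerivAt (fun s : ℝ => f (t + s * d) - f t - (s * d) • deriv f t)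
      (d • deriv f (t + s * d) - d • deriv f t) s := by
    have h₁ := (hf (t + s * d)).hasDerivAt.scomp s (hline s)
    have h₂ : HasDerivAt (fun s : ℝ => (s * d) • deriv f t) (d • deriv f t) s := by
      simpa using ((hasDerivAt_id s).mul_const d).smul_const (deriv f t)
    exact (h₁.sub_const (f t)).sub h₂
  have hB (s : ℝ) : HasDerivAt (fun s : ℝ => M / 2 * d ^ 2 * s ^ 2) (M * d ^ 2 * s) s := by
    refine ((hasDerivAt_pow 2 s).const_mul (M / 2 * d ^ 2)).congr_deriv ?_
    push_cast
    ring
  have hlip (v : ℝ) : ‖deriv f v - deriv f t‖ ≤ M * ‖v - t‖ :=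
    convex_univ.norm_image_sub_le_of_norm_deriv_le (fun s _ => hf' s) (fun s _ => hM s)
      (Set.mem_univ t) (Set.mem_univ v)
  have key := image_norm_le_of_norm_deriv_right_le_deriv_boundary (a := 0) (b := 1)
    (fun s _ => (hg s).continuousAt.continuousWithinAt)
    (fun s _ => (hg s).hasDerivWithinAt) (by simp) hB
    (fun s hs => by
      rw [← smul_sub, norm_smul]
      calc ‖d‖ * ‖deriv f (t + s * d) - deriv f t‖
          ≤ ‖d‖ * (M * ‖t + s * d - t‖) := by gcongr; exact hlip _
        _ = M * d ^ 2 * s := by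
          rw [add_sub_cancel_left, norm_mul, Real.norm_of_nonneg hs.1, Real.norm_eq_abs, ← sq_abs d]
          ring)
    (Set.right_mem_Icc.2 zero_le_one)
  simpa [hd] using key

/-- A nonnegative sequence with `e (n + 1) ≤ C * e n ^ 2` decays doubly exponentially. -/
theorem le_inv_mul_pow_two_pow_of_le_mul_sq {e : ℕ → ℝ} {C : ℝ} (hC : 0 < C)
    (he : ∀ n, 0 ≤ e n) (h : ∀ n, e (n + 1) ≤ C * e n ^ 2) (n : ℕ) :
    e n ≤ C⁻¹ * (C * e 0) ^ 2 ^ n := by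
  rw [le_inv_mul_iff₀ hC]
  induction n with
  | zero => simp
  | succ n ih =>
    calc C * e (n + 1) ≤ C * (C * e n ^ 2) := by gcongr; exact h n
      _ = (C * e n) ^ 2 := by ring
      _ ≤ ((C * e 0) ^ 2 ^ n) ^ 2 := by
        have := mul_nonneg hC.le (he n)
        gcongr
      _ = (C * e 0) ^ 2 ^ (n + 1) := by rw [← pow_mul, pow_succ]

/-- Proposition 1, coordinate form. Let `x : ℝ → ℝ³` be twice
differentiable with `‖ẍ‖ ≤ A` and `‖ẋ‖ ≤ k < 1` everywhere, `‖a‖ ≤ 1`, and let `ttil` be a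
root of `t + a·x(t) = b`.  Set `C := A/(2(1 − k))`.  Then for every starting point `t₀`
with `C·|t₀ − ttil| < 1`, the Newton–Raphson sequence `t_{n+1} = N(t_n)` is well defined
(indeed `1 + a·ẋ(t_n) ≥ 1 − k > 0`), satisfies `|t_{n+1} − ttil| ≤ C·|t_n − ttil|²`, hence
`|t_n − ttil| ≤ C⁻¹·(C·|t₀ − ttil|)^(2^n)`, and converges to `ttil`. -/
theorem stmt3 (x : ℝ → E3) (hx : ∀ s : ℝ, DifferentiableAt ℝ x s)
    (hx' : ∀ s : ℝ, DifferentiableAt ℝ (deriv x) s)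
    (A k : ℝ) (hA : 0 < A) (hk0 : 0 ≤ k) (hk1 : k < 1)
    (hacc : ∀ t : ℝ, ‖deriv (deriv x) t‖ ≤ A)
    (hvel : ∀ t : ℝ, ‖deriv x t‖ ≤ k)
    (a : E3) (ha : ‖a‖ ≤ 1) (b ttil : ℝ) (hroot : ttil + ⟪a, x ttil⟫ = b)
    (C : ℝ) (hC : C = A / (2 * (1 - k)))
    (t₀ : ℝ) (hstart : C * |t₀ - ttil| < 1)
    (tseq : ℕ → ℝ) (h0 : tseq 0 = t₀)
    (hrec : ∀ n : ℕ, tseq (n + 1) = NR x a b (tseq n)) :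
    (∀ n : ℕ, 1 - k ≤ 1 + ⟪a, deriv x (tseq n)⟫ ∧ 0 < 1 - k) ∧
    (∀ n : ℕ, |tseq (n + 1) - ttil| ≤ C * |tseq n - ttil| ^ 2) ∧
    (∀ n : ℕ, |tseq n - ttil| ≤ C⁻¹ * (C * |t₀ - ttil|) ^ 2 ^ n) ∧
    Filter.Tendsto tseq Filter.atTop (nhds ttil) := by
  have hk : 0 < 1 - k := sub_pos.2 hk1
  have hCpos : 0 < C := hC ▸ by positivity
  have hden (t : ℝ) : 1 - k ≤ 1 + ⟪a, deriv x t⟫ := by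
    have h₁ : |⟪a, deriv x t⟫| ≤ 1 * k :=
      (abs_real_inner_le_norm _ _).trans (mul_le_mul ha (hvel t) (norm_nonneg _) zero_le_one)
    linarith [neg_abs_le ⟪a, deriv x t⟫]
  have hstep (n : ℕ) : |tseq (n + 1) - ttil| ≤ C * |tseq n - ttil| ^ 2 := by
    rw [hrec n]
    set t := tseq n
    have hpos : 0 < 1 + ⟪a, deriv x t⟫ := hk.trans_le (hden t)
    have herr : NR x a b t - ttil
        = ⟪a, x ttil - x t - (ttil - t) • deriv x t⟫ / (1 + ⟪a, deriv x t⟫) := by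
      rw [NR, eq_div_iff hpos.ne', sub_mul, div_mul_cancel₀ _ hpos.ne', ← hroot]
      simp only [inner_sub_right, real_inner_smul_right]
      ring
    have hnum : |⟪a, x ttil - x t - (ttil - t) • deriv x t⟫| ≤ 1 * (A / 2 * |ttil - t| ^ 2) :=
      (abs_real_inner_le_norm _ _).trans
        (mul_le_mul ha (norm_sub_sub_smul_deriv_le hx hx' hacc t ttil) (norm_nonneg _) zero_le_one)
    rw [herr, abs_div, abs_of_pos hpos]
    calc _ ≤ 1 * (A / 2 * |ttil - t| ^ 2) / (1 - k) :=
          div_le_div₀ (by positivity) hnum hk (hden t)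
      _ = C * |t - ttil| ^ 2 := by
        rw [hC, abs_sub_comm]
        field_simp
  have hbound (n : ℕ) : |tseq n - ttil| ≤ C⁻¹ * (C * |t₀ - ttil|) ^ 2 ^ n := by
    have := le_inv_mul_pow_two_pow_of_le_mul_sq hCpos (fun n => abs_nonneg (tseq n - ttil)) hstep n
    rwa [h0] at this
  refine ⟨fun n => ⟨hden _, hk⟩, hstep, hbound, ?_⟩
  have hlim : Filter.Tendsto (fun n : ℕ => C⁻¹ * (C * |t₀ - ttil|) ^ 2 ^ n)
      Filter.atTop (nhds 0) := by
    simpa using ((tendsto_pow_atTop_nhds_zero_of_lt_one (by positivity) hstart).comp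
      (tendsto_pow_atTop_atTop_of_one_lt one_lt_two)).const_mul C⁻¹
  rw [tendsto_iff_dist_tendsto_zero]
  exact squeeze_zero (fun _ => dist_nonneg) hbound hlim
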